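/- Rellich-type identity: let R > 0, let A = [a_{ij}] be a symmetric N×N matrix-valued C¹ function, let G be a C¹ vector field on an open neighborhood of the closure of B_R, and let u be a smooth function compactly supported in B_R. Then, since div X_i = 0 for each of the Baouendi–Grushin vector fields, one has 2 ∫_{B_R} (Gu) Σ_{i,j=1}^N X_i(a_{ij} X_j u) = ∫_{B_R} (div G) ⟨A Xu, Xu⟩ + ∫_{B_R} ⟨(GA) Xu, Xu⟩ − 2 ∫_{B_R} Σ_{i,j=1}^N a_{ij} (X_i u) [X_j, G]u, where GA is the matrix with entries G(a_{ij}), Gu denotes the derivative of u along G, and [X_j, G]u = X_j(Gu) − G(X_j u). -/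

import Mathlib

open MeasureTheory Real Set Filter Asymptotics

noncomputable section

/-- The underlying space ℝ^m × ℝ^k. -/
abbrev E (m k : ℕ) : Type :=
  EuclideanSpace ℝ (Fin m) × EuclideanSpace ℝ (Fin k)

namespace BG

variable {m k : ℕ}

/-- The Baouendi–Grushin gauge ρ. -/
def rho (γ : ℝ) (p : E m k) : ℝ :=
  (‖p.1‖ ^ (2 * (γ + 1)) + (γ + 1) ^ 2 * ‖p.2‖ ^ 2) ^ (1 / (2 * (γ + 1)))

/-- The angle function ψ = |z|^{2γ}/ρ^{2γ}. -/
def psi (γ : ℝ) (p : E m k) : ℝ :=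
  ‖p.1‖ ^ (2 * γ) / rho γ p ^ (2 * γ)

/-- The gauge ball B_r = {ρ < r}. -/
def ball (γ r : ℝ) : Set (E m k) := {p | rho γ p < r}

/-- The Baouendi–Grushin vector fields as direction fields:
X_i = ∂_{z_i} for i < m, X_{m+j} = |z|^γ ∂_{t_j}. -/
def Xvec (γ : ℝ) (p : E m k) (i : Fin (m + k)) : E m k :=
  if h : (i : ℕ) < m then (EuclideanSpace.single ⟨(i : ℕ), h⟩ 1, 0)
  else (0, EuclideanSpace.single ⟨(i : ℕ) - m, by have := i.isLt; omega⟩ (‖p.1‖ ^ γ))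

/-- Derivative along the i-th Baouendi–Grushin vector field. -/
def Xd (γ : ℝ) (i : Fin (m + k)) (f : E m k → ℝ) (p : E m k) : ℝ :=
  fderiv ℝ f p (Xvec γ p i)

/-- The quadratic form ⟨A Xu, Xu⟩. -/
def quadA (γ : ℝ) (A : E m k → Matrix (Fin (m + k)) (Fin (m + k)) ℝ)
    (u : E m k → ℝ) (p : E m k) : ℝ :=
  ∑ i, ∑ j, A p i j * Xd γ i u p * Xd γ j u p

/-- μ = ⟨A Xρ, Xρ⟩. -/
def mu (γ : ℝ) (A : E m k → Matrix (Fin (m + k)) (Fin (m + k)) ℝ) (p : E m k) : ℝ :=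
  quadA γ A (rho γ) p

/-- The operator 𝓛 u = Σ_{i,j} X_i(a_{ij} X_j u). -/
def Lop (γ : ℝ) (A : E m k → Matrix (Fin (m + k)) (Fin (m + k)) ℝ)
    (u : E m k → ℝ) (p : E m k) : ℝ :=
  ∑ i, ∑ j, Xd γ i (fun q => A q i j * Xd γ j u q) p

/-- The vector field F = (ρ/μ) Σ a_{ij} X_iρ X_j, as a first order operator. -/
def Fop (γ : ℝ) (A : E m k → Matrix (Fin (m + k)) (Fin (m + k)) ℝ)
    (v : E m k → ℝ) (p : E m k) : ℝ :=
  rho γ p / mu γ A p * ∑ i, ∑ j, A p i j * Xd γ i (rho γ) p * Xd γ j v p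

/-- The Baouendi–Grushin operator 𝓑_γ = Δ_z + |z|^{2γ} Δ_t = Σ_i X_i X_i. -/
def Bop (γ : ℝ) (u : E m k → ℝ) (p : E m k) : ℝ :=
  ∑ i : Fin (m + k), Xd γ i (Xd γ i u) p

/-- The generator of anisotropic dilations Z = Σ z_i ∂_{z_i} + (γ+1) Σ t_j ∂_{t_j},
as a first order operator: the derivative in the direction (z, (γ+1) t). -/
def Zd (γ : ℝ) (v : E m k → ℝ) (p : E m k) : ℝ :=
  fderiv ℝ v p (p.1, (γ + 1) • p.2)

/-- The Euclidean divergence of a vector field on ℝ^m × ℝ^k. -/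
def divV (V : E m k → E m k) (p : E m k) : ℝ :=
  (∑ i : Fin m, (fderiv ℝ V p (EuclideanSpace.single i 1, 0)).1 i) +
    ∑ j : Fin k,
      (fderiv ℝ V p ((0 : EuclideanSpace ℝ (Fin m)), EuclideanSpace.single j 1)).2 j

/-- Uniform ellipticity: λ|η|² ≤ ⟨Aη,η⟩ ≤ λ⁻¹|η|². -/
def Elliptic (lam : ℝ) (A : E m k → Matrix (Fin (m + k)) (Fin (m + k)) ℝ) : Prop :=
  ∀ (p : E m k) (η : Fin (m + k) → ℝ),
    lam * ∑ i, η i ^ 2 ≤ ∑ i, ∑ j, A p i j * η i * η j ∧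
      ∑ i, ∑ j, A p i j * η i * η j ≤ lam⁻¹ * ∑ i, η i ^ 2

/-- Symmetry of the matrix A. -/
def Symm (A : E m k → Matrix (Fin (m + k)) (Fin (m + k)) ℝ) : Prop :=
  ∀ p i j, A p i j = A p j i

/-- The entries of A are C¹. -/
def C1coeff (A : E m k → Matrix (Fin (m + k)) (Fin (m + k)) ℝ) : Prop :=
  ∀ i j, ContDiff ℝ 1 fun p => A p i j

/-- The structural hypothesis (H) on B = A - I, in B_1. -/
def HypH (γ Λ : ℝ) (A : E m k → Matrix (Fin (m + k)) (Fin (m + k)) ℝ) : Prop :=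
  ∀ p ∈ ball (m := m) (k := k) γ 1,
    (∀ i j : Fin (m + k),
        |(A p - 1) i j| ≤
          if (i : ℕ) < m ∧ (j : ℕ) < m then Λ * rho γ p
          else Λ * psi γ p ^ ((1 : ℝ) / 2 + 1 / (2 * γ)) * rho γ p) ∧
      ∀ l i j : Fin (m + k),
        |Xd γ l (fun q => (A q - 1) i j) p| ≤
          if (l : ℕ) < m ∧ (i : ℕ) < m ∧ (j : ℕ) < m then Λ
          else if m ≤ (l : ℕ) ∧ (m ≤ (i : ℕ) ∨ m ≤ (j : ℕ)) then
            Λ * psi γ p ^ ((1 : ℝ) + 1 / (2 * γ))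
          else Λ * psi γ p ^ ((1 : ℝ) / 2)

end BG

namespace BGaux

open BG Topology

variable {m k : ℕ}

/-- The weight ‖z‖^α. -/
def wt (α : ℝ) (p : E m k) : ℝ := ‖p.1‖ ^ α

/-- The directional derivative of the weight ‖z‖^α off z = 0. -/
def dwt (α : ℝ) (p v : E m k) : ℝ := α * ‖p.1‖ ^ (α - 2) * inner ℝ p.1 v.1

lemma wt_continuous {α : ℝ} (hα : 0 ≤ α) : Continuous (wt α : E m k → ℝ) := by
  unfold wt
  exact (continuous_fst.norm).rpow_const (fun _ => Or.inr hα)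

lemma locInt_rpow (hm : 1 ≤ m) {α : ℝ} (hα : 0 < α) :
    LocallyIntegrable (fun z : EuclideanSpace ℝ (Fin m) => ‖z‖ ^ (α - 1)) := by
  have : Nonempty (Fin m) := ⟨⟨0, hm⟩⟩
  have : Nontrivial (EuclideanSpace ℝ (Fin m)) := inferInstance
  rw [locallyIntegrable_iff]
  intro K hK
  obtain ⟨r, hr⟩ := hK.isBounded.subset_ball 0
  refine IntegrableOn.mono_set ?_ hr
  rw [integrableOn_fun_norm_addHaar volume (f := fun y : ℝ => y ^ (α - 1))]
  have h1 : IntegrableOn (fun y : ℝ => y ^ (((m : ℝ) - 1) + (α - 1))) (Ioo 0 r) := by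
    rcases le_or_gt r 0 with h | h
    · simp [Ioo_eq_empty_of_le h]
    · rw [intervalIntegral.integrableOn_Ioo_rpow_iff h]
      have : (1 : ℝ) ≤ m := by exact_mod_cast hm
      linarith
  refine h1.congr_fun ?_ measurableSet_Ioo
  intro y hy
  simp only [finrank_euclideanSpace, Fintype.card_fin, smul_eq_mul]
  rw [Real.rpow_add hy.1, ← Real.rpow_natCast, Nat.cast_sub hm, Nat.cast_one]

lemma locInt_wt (hm : 1 ≤ m) {α : ℝ} (hα : 0 ≤ α) :
    LocallyIntegrable (fun p : E m k => α * ‖p.1‖ ^ (α - 1)) := by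
  rcases hα.eq_or_lt with rfl | hα
  · simpa using (locallyIntegrable_zero (μ := (volume : Measure (E m k))) (ε'' := ℝ))
  rw [locallyIntegrable_iff]
  intro K hK
  have hK1 := hK.image continuous_fst
  have hK2 := hK.image continuous_snd
  have hsub : K ⊆ (Prod.fst '' K) ×ˢ (Prod.snd '' K) := fun p hp =>
    ⟨⟨p, hp, rfl⟩, ⟨p, hp, rfl⟩⟩
  refine IntegrableOn.mono_set ?_ hsub
  have h1 : IntegrableOn (fun z : EuclideanSpace ℝ (Fin m) => α * ‖z‖ ^ (α - 1)) (Prod.fst '' K) :=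
    ((locInt_rpow hm hα).integrableOn_isCompact hK1).const_mul _
  have h2 : IntegrableOn (fun _ : EuclideanSpace ℝ (Fin k) => (1 : ℝ)) (Prod.snd '' K) :=
    continuous_const.locallyIntegrable.integrableOn_isCompact hK2
  have := Integrable.mul_prod h1 h2
  rw [Measure.prod_restrict] at this
  simpa [IntegrableOn, Measure.volume_eq_prod] using this

lemma ae_ne (hm : 1 ≤ m) : ∀ᵐ p : E m k, p.1 ≠ 0 := by
  have : Nonempty (Fin m) := ⟨⟨0, hm⟩⟩
  have : Nontrivial (EuclideanSpace ℝ (Fin m)) := inferInstance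
  have h : ∀ᵐ z : EuclideanSpace ℝ (Fin m), z ≠ 0 := by
    simp [ae_iff]
  have := (Measure.quasiMeasurePreserving_fst
    (μ := (volume : Measure (EuclideanSpace ℝ (Fin m))))
    (ν := (volume : Measure (EuclideanSpace ℝ (Fin k))))).ae h
  exact this

lemma inner_bound {α : ℝ} (hα : 0 ≤ α) (z v : EuclideanSpace ℝ (Fin m)) :
    |α * ‖z‖ ^ (α - 2) * inner ℝ z v| ≤ α * ‖z‖ ^ (α - 1) * ‖v‖ := by
  rcases eq_or_ne z 0 with rfl | hz
  · simp only [inner_zero_left, mul_zero, abs_zero]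
    positivity
  have hz' : 0 < ‖z‖ := norm_pos_iff.mpr hz
  have e : ‖z‖ ^ (α - 1) = ‖z‖ ^ (α - 2) * ‖z‖ := by
    rw [← Real.rpow_add_one hz'.ne']; congr 1; ring
  rw [e, abs_mul, abs_of_nonneg (by positivity)]
  have := abs_real_inner_le_norm z v
  calc _ ≤ α * ‖z‖ ^ (α - 2) * (‖z‖ * ‖v‖) := by gcongr
    _ = _ := by ring

lemma dwt_integrable (hm : 1 ≤ m) {α : ℝ} (hα : 0 ≤ α) (V : E m k → E m k) (hV : Continuous V)
    (hVc : HasCompactSupport V) : Integrable (fun p => dwt α p (V p)) := by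
  have h1 : Integrable (fun p : E m k => (α * ‖p.1‖ ^ (α - 1)) * ‖V p‖) :=
    (locInt_wt hm hα).integrable_smul_right_of_hasCompactSupport hV.norm hVc.norm
  refine h1.mono' ?_ (Eventually.of_forall fun p => ?_)
  · refine Measurable.aestronglyMeasurable ?_
    unfold dwt
    have : Measurable V := hV.measurable
    fun_prop
  · refine (inner_bound hα p.1 (V p).1).trans ?_
    gcongr
    exact norm_fst_le (V p)

lemma haar_volume : (volume : Measure (E m k)).IsAddHaarMeasure := by
  rw [Measure.volume_eq_prod]; infer_instance

lemma integral_fderiv_zero (f : E m k → ℝ) (hf : ContDiff ℝ 1 f) (hc : HasCompactSupport f)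
    (v : E m k) : ∫ p, fderiv ℝ f p v = 0 := by
  have hc' : HasCompactSupport (fun p => fderiv ℝ f p v) := hc.fderiv_apply ℝ v
  have hcont : Continuous (fun p => fderiv ℝ f p v) :=
    (hf.continuous_fderiv one_ne_zero).clm_apply continuous_const
  have := haar_volume (m := m) (k := k)
  have := integral_mul_fderiv_eq_neg_fderiv_mul_of_integrable (μ := (volume : Measure (E m k)))
    (f := fun _ => (1 : ℝ)) (g := f) (v := v) (by simp)
    (by simpa using hcont.integrable_of_hasCompactSupport hc')
    (by simpa using hf.continuous.integrable_of_hasCompactSupport hc)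
    (fun _ _ => differentiableAt_const _) (fun x _ => hf.differentiable one_ne_zero x)
  simpa using this

lemma hasFDerivAt_reg (α ε : ℝ) (p : E m k) (h : 0 < ‖p.1‖ ^ 2 + ε) :
    HasFDerivAt (fun q : E m k => (‖q.1‖ ^ 2 + ε) ^ (α / 2))
      ((α * (‖p.1‖ ^ 2 + ε) ^ (α / 2 - 1)) •
        ((innerSL ℝ p.1).comp (ContinuousLinearMap.fst ℝ _ _))) p := by
  have h1 : HasFDerivAt (fun q : E m k => ‖q.1‖ ^ 2 + ε)
      (2 • ((innerSL ℝ p.1).comp (ContinuousLinearMap.fst ℝ _ _))) p :=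
    ((hasFDerivAt_fst (𝕜 := ℝ) (p := p)).norm_sq).add_const ε
  have h2 := h1.rpow_const (p := α / 2) (Or.inl h.ne')
  refine h2.congr_fderiv ?_
  rw [← Nat.cast_smul_eq_nsmul ℝ, smul_smul]
  congr 1
  push_cast; ring

lemma hasFDerivAt_wt (α : ℝ) (p : E m k) (h : p.1 ≠ 0) :
    HasFDerivAt (wt α : E m k → ℝ)
      ((α * ‖p.1‖ ^ (α - 2)) •
        ((innerSL ℝ p.1).comp (ContinuousLinearMap.fst ℝ _ _))) p := by
  have hp : 0 < ‖p.1‖ := norm_pos_iff.mpr h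
  have h1 := hasFDerivAt_reg (m := m) (k := k) α 0 p (by positivity)
  convert h1 using 1
  · funext q
    rw [add_zero, ← Real.rpow_natCast, ← Real.rpow_mul (norm_nonneg _)]
    unfold wt; congr 1; push_cast; ring
  · rw [add_zero, ← Real.rpow_natCast, ← Real.rpow_mul (norm_nonneg _)]
    congr 3; push_cast; ring

lemma fderiv_wt (α : ℝ) (p v : E m k) (h : p.1 ≠ 0) : fderiv ℝ (wt α) p v = dwt α p v := by
  rw [(hasFDerivAt_wt α p h).fderiv]; simp [dwt]

/-- The key lemma: ∫ ∂_v (‖z‖^α f) = 0. -/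
lemma integral_wt (hm : 1 ≤ m) {α : ℝ} (hα : 0 ≤ α) (f : E m k → ℝ) (hf : ContDiff ℝ 1 f)
    (hc : HasCompactSupport f) (v : E m k) :
    Integrable (fun p => wt α p * fderiv ℝ f p v + dwt α p v * f p) ∧
    ∫ p, (wt α p * fderiv ℝ f p v + dwt α p v * f p) = 0 := by
  have hc' : HasCompactSupport (fun p => fderiv ℝ f p v) := hc.fderiv_apply ℝ v
  have hcont : Continuous (fun p => fderiv ℝ f p v) :=
    (hf.continuous_fderiv one_ne_zero).clm_apply continuous_const
  have hi1 : Integrable (fun p => wt α p * fderiv ℝ f p v) :=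
    ((wt_continuous hα).mul hcont).integrable_of_hasCompactSupport hc'.mul_left
  have hi2 : Integrable (fun p => dwt α p v * f p) := by
    have := dwt_integrable (m := m) (k := k) hm hα (fun p => f p • v)
      (hf.continuous.smul continuous_const) hc.smul_right
    refine this.congr (Eventually.of_forall fun p => ?_)
    simp [dwt, inner_smul_right]; ring
  refine ⟨hi1.add hi2, ?_⟩
  -- regularisation
  let ε : ℕ → ℝ := fun n => 1 / ((n : ℝ) + 1)
  have hε0 : ∀ n, 0 < ε n := fun n => by positivity
  have hε1 : ∀ n, ε n ≤ 1 := fun n => by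
    simp only [ε]; rw [div_le_one (by positivity)]; linarith [Nat.cast_nonneg (α := ℝ) n]
  have hεt : Tendsto ε atTop (𝓝 0) := tendsto_one_div_add_atTop_nhds_zero_nat
  let W : ℕ → E m k → ℝ := fun n p => (‖p.1‖ ^ 2 + ε n) ^ (α / 2)
  let F : ℕ → E m k → ℝ := fun n p => W n p * fderiv ℝ f p v +
    α * (‖p.1‖ ^ 2 + ε n) ^ (α / 2 - 1) * inner ℝ p.1 v.1 * f p
  have hpos : ∀ n (p : E m k), 0 < ‖p.1‖ ^ 2 + ε n := fun n p => by
    have := hε0 n; positivity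
  have hWC : ∀ n, ContDiff ℝ 1 (W n) := fun n =>
    ((contDiff_fst.norm_sq ℝ).add contDiff_const).rpow_const_of_ne (fun p => (hpos n p).ne')
  have hFz : ∀ n, ∫ p, F n p = 0 := by
    intro n
    rw [← integral_fderiv_zero (fun p => W n p * f p) ((hWC n).mul hf) hc.mul_left v]
    congr 1; funext p
    have := (hasFDerivAt_reg α (ε n) p (hpos n p)).fun_mul
      (hf.differentiable one_ne_zero p).hasFDerivAt
    simp only [W]
    rw [HasFDerivAt.fderiv this]
    simp [F, W]; ring
  have hcW : Continuous (fun p : E m k => (‖p.1‖ ^ 2 + 1) ^ (α / 2)) :=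
    Continuous.rpow_const (by fun_prop) (fun p => Or.inl (by positivity))
  have hcW' : Continuous (fun p : E m k => (‖p.1‖ ^ 2 + 1) ^ (α / 2 - 1)) :=
    Continuous.rpow_const (by fun_prop) (fun p => Or.inl (by positivity))
  let B : E m k → ℝ := fun p => |(‖p.1‖ ^ 2 + 1) ^ (α / 2) * fderiv ℝ f p v| +
    (α * ‖p.1‖ ^ (α - 1) * (‖v‖ * ‖f p‖) +
      α * (‖p.1‖ ^ 2 + 1) ^ (α / 2 - 1) * ‖p.1‖ * ‖v‖ * ‖f p‖)
  have hB : Integrable B := by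
    refine Integrable.add ?_ (Integrable.add ?_ ?_)
    · exact ((hcW.mul hcont).integrable_of_hasCompactSupport hc'.mul_left).abs
    · exact (locInt_wt hm hα).integrable_smul_right_of_hasCompactSupport
        (continuous_const.mul hf.continuous.norm) hc.norm.mul_left
    · refine Continuous.integrable_of_hasCompactSupport ?_ hc.norm.mul_left
      have := hf.continuous
      fun_prop
  have key : Tendsto (fun n => ∫ p, F n p) atTop
      (𝓝 (∫ p, (wt α p * fderiv ℝ f p v + dwt α p v * f p))) := by
    refine tendsto_integral_of_dominated_convergence B ?_ hB ?_ ?_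
    · intro n
      refine Measurable.aestronglyMeasurable ?_
      have := hcont.measurable
      have := hf.continuous.measurable
      simp only [F, W]
      fun_prop
    · intro n
      filter_upwards [ae_ne hm] with p hp
      have hp' : 0 < ‖p.1‖ := norm_pos_iff.mpr hp
      refine (norm_add_le _ _).trans ?_
      simp only [B]
      gcongr ?_ + ?_
      · simp only [W]
        rw [Real.norm_eq_abs, abs_mul, abs_mul]
        gcongr ?_ * _
        rw [abs_of_nonneg (by have := hpos n p; positivity), abs_of_nonneg (by positivity)]
        have := hpos n p
        gcongr
        exact hε1 n
      · have hin := abs_real_inner_le_norm p.1 v.1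
        have hv : ‖v.1‖ ≤ ‖v‖ := norm_fst_le v
        have hb : (‖p.1‖ ^ 2 + ε n) ^ (α / 2 - 1) ≤
            ‖p.1‖ ^ (α - 2) + (‖p.1‖ ^ 2 + 1) ^ (α / 2 - 1) := by
          rcases le_total 0 (α / 2 - 1) with h | h
          · have h1 : (‖p.1‖ ^ 2 + ε n) ^ (α / 2 - 1) ≤ (‖p.1‖ ^ 2 + 1) ^ (α / 2 - 1) :=
              Real.rpow_le_rpow (hpos n p).le (by linarith [hε1 n]) h
            have : 0 ≤ ‖p.1‖ ^ (α - 2) := by positivity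
            linarith
          · have h1 : (‖p.1‖ ^ 2 + ε n) ^ (α / 2 - 1) ≤ (‖p.1‖ ^ 2) ^ (α / 2 - 1) :=
              Real.rpow_le_rpow_of_nonpos (by positivity) (by linarith [hε0 n]) h
            rw [← Real.rpow_natCast, ← Real.rpow_mul (norm_nonneg _)] at h1
            have e : ((2 : ℕ) : ℝ) * (α / 2 - 1) = α - 2 := by push_cast; ring
            rw [e] at h1
            have : 0 ≤ (‖p.1‖ ^ 2 + 1) ^ (α / 2 - 1) := by positivity
            simp only [Real.rpow_natCast] at h1
            linarith
        have e : ‖p.1‖ ^ (α - 1) = ‖p.1‖ ^ (α - 2) * ‖p.1‖ := by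
          rw [← Real.rpow_add_one hp'.ne']; congr 1; ring
        rw [norm_mul, norm_mul, Real.norm_eq_abs (inner ℝ _ _), Real.norm_eq_abs (α * _),
          abs_of_nonneg (mul_nonneg hα (Real.rpow_nonneg (hpos n p).le _)), e]
        calc _ ≤ α * (‖p.1‖ ^ (α - 2) + (‖p.1‖ ^ 2 + 1) ^ (α / 2 - 1)) * (‖p.1‖ * ‖v‖) * ‖f p‖ := by
              gcongr
              exact hin.trans (by gcongr)
          _ = _ := by ring
    · filter_upwards [ae_ne hm] with p hp
      have hp' : 0 < ‖p.1‖ := norm_pos_iff.mpr hp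
      have hb : Tendsto (fun n => ‖p.1‖ ^ 2 + ε n) atTop (𝓝 (‖p.1‖ ^ 2)) := by
        simpa using hεt.const_add (‖p.1‖ ^ 2)
      have hr : ∀ β : ℝ, Tendsto (fun n => (‖p.1‖ ^ 2 + ε n) ^ β) atTop (𝓝 (‖p.1‖ ^ (2 * β))) := by
        intro β
        have := hb.rpow_const (p := β) (Or.inl (by positivity))
        rw [← Real.rpow_natCast ‖p.1‖ 2, ← Real.rpow_mul (norm_nonneg _)] at this
        simpa using this
      have h1 := hr (α / 2)
      have h2 := hr (α / 2 - 1)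
      rw [show 2 * (α / 2) = α by ring] at h1
      rw [show 2 * (α / 2 - 1) = α - 2 by ring] at h2
      exact (h1.mul_const _).add (((h2.const_mul α).mul_const _).mul_const _)
  simp only [hFz] at key
  exact (tendsto_nhds_unique key tendsto_const_nhds)

/-- The exponent of the weight of X_i. -/
def gm (m : ℕ) {k : ℕ} (γ : ℝ) (i : Fin (m + k)) : ℝ := if (i : ℕ) < m then 0 else γ

/-- The constant coordinate directions. -/
def bv (i : Fin (m + k)) : E m k := Xvec 0 0 i

/-- The coordinate functionals. -/
def cv (l : Fin (m + k)) : E m k →L[ℝ] ℝ :=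
  if h : (l : ℕ) < m then
    (EuclideanSpace.proj (⟨(l : ℕ), h⟩ : Fin m) : EuclideanSpace ℝ (Fin m) →L[ℝ] ℝ).comp
      (ContinuousLinearMap.fst ℝ _ _)
  else
    (EuclideanSpace.proj (⟨(l : ℕ) - m, by have := l.isLt; omega⟩ : Fin k) :
      EuclideanSpace ℝ (Fin k) →L[ℝ] ℝ).comp (ContinuousLinearMap.snd ℝ _ _)

lemma gm_nonneg {γ : ℝ} (hγ : 0 < γ) (i : Fin (m + k)) : 0 ≤ gm m γ i := by
  unfold gm; split_ifs <;> linarith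

lemma Xvec_eq (γ : ℝ) (p : E m k) (i : Fin (m + k)) :
    Xvec γ p i = wt (gm m γ i) p • bv i := by
  unfold Xvec bv Xvec wt gm
  split_ifs with h
  · simp
  · ext j <;> simp

lemma Xd_eq (γ : ℝ) (i : Fin (m + k)) (h : E m k → ℝ) (p : E m k) :
    Xd γ i h p = wt (gm m γ i) p * fderiv ℝ h p (bv i) := by
  unfold Xd; rw [Xvec_eq, map_smul, smul_eq_mul]

lemma dwt_bv (γ : ℝ) (i : Fin (m + k)) (p : E m k) : dwt (gm m γ i) p (bv i) = 0 := by
  unfold dwt gm bv Xvec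
  split_ifs with h <;> simp

lemma bv_castAdd (i : Fin m) : (bv (Fin.castAdd k i) : E m k) = (EuclideanSpace.single i 1, 0) := by
  simp [bv, Xvec]

lemma bv_natAdd (j : Fin k) : (bv (Fin.natAdd m j) : E m k) = (0, EuclideanSpace.single j 1) := by
  simp [bv, Xvec]

lemma cv_castAdd (i : Fin m) (v : E m k) : cv (Fin.castAdd k i) v = v.1 i := by
  simp [cv]

lemma cv_natAdd (j : Fin k) (v : E m k) : cv (Fin.natAdd m j) v = v.2 j := by
  simp [cv]

lemma sum_cv (v : E m k) : ∑ l, cv l v • (bv l : E m k) = v := by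
  rw [Fin.sum_univ_add]
  simp only [cv_castAdd, cv_natAdd, bv_castAdd, bv_natAdd]
  ext j
  · simp [Prod.fst_sum, Finset.sum_apply, Pi.single_apply]
  · simp [Prod.snd_sum, Finset.sum_apply, Pi.single_apply]

lemma divV_eq (G : E m k → E m k) (p : E m k) :
    divV G p = ∑ l, cv l (fderiv ℝ G p (bv l)) := by
  rw [Fin.sum_univ_add]
  simp only [cv_castAdd, cv_natAdd, bv_castAdd, bv_natAdd]
  rfl

lemma fderiv_mul_app {a b : E m k → ℝ} {p : E m k} (ha : DifferentiableAt ℝ a p)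
    (hb : DifferentiableAt ℝ b p) (v : E m k) :
    fderiv ℝ (fun q => a q * b q) p v = a p * fderiv ℝ b p v + fderiv ℝ a p v * b p := by
  rw [fderiv_fun_mul ha hb]; simp; ring

lemma wt_add {α β : ℝ} (hα : 0 ≤ α) (hβ : 0 ≤ β) (p : E m k) :
    wt (α + β) p = wt α p * wt β p := Real.rpow_add_of_nonneg (norm_nonneg _) hα hβ

lemma fderiv_wt_mul {α : ℝ} {f : E m k → ℝ} {p : E m k} (hp : p.1 ≠ 0)
    (hf : DifferentiableAt ℝ f p) (v : E m k) :
    fderiv ℝ (fun q => wt α q * f q) p v = wt α p * fderiv ℝ f p v + dwt α p v * f p := by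
  rw [fderiv_mul_app (hasFDerivAt_wt α p hp).differentiableAt hf, fderiv_wt α p v hp]

lemma alg {ι : Type*} [Fintype ι] (a M Ga : ι → ι → ℝ) (x Gx Xg : ι → ℝ) (g d : ℝ)
    (hs : ∀ i j, a i j = a j i) :
    2 * (g * ∑ i, ∑ j, M i j) - d * ∑ i, ∑ j, a i j * x i * x j
      - ∑ i, ∑ j, Ga i j * x i * x j + 2 * ∑ i, ∑ j, a i j * x i * (Xg j - Gx j)
    = ∑ i, ∑ j, 2 * (g * M i j + Xg i * (a i j * x j))
      - ∑ i, ∑ j, (a i j * (x i * x j) * d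
          + (a i j * (x i * Gx j + Gx i * x j) + Ga i j * (x i * x j))) := by
  have swap : ∀ y : ι → ℝ, ∑ i, ∑ j, a i j * y i * x j = ∑ i, ∑ j, a i j * x i * y j := by
    intro y
    rw [Finset.sum_comm]
    refine Finset.sum_congr rfl fun i _ => Finset.sum_congr rfl fun j _ => ?_
    rw [hs]; ring
  have h1 := swap Xg
  have h2 := swap Gx
  rw [← sub_eq_zero] at h1 h2 ⊢
  refine Eq.trans ?_ (show (-2 : ℝ) * (∑ i, ∑ j, a i j * Xg i * x j
    - ∑ i, ∑ j, a i j * x i * Xg j) + (∑ i, ∑ j, a i j * Gx i * x j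
    - ∑ i, ∑ j, a i j * x i * Gx j) = 0 by rw [h1, h2]; norm_num)
  simp only [Finset.mul_sum, ← Finset.sum_sub_distrib, ← Finset.sum_add_distrib]
  refine Finset.sum_congr rfl fun i _ => Finset.sum_congr rfl fun j _ => ?_
  ring

section main

variable (hm : 1 ≤ m) {γ : ℝ} (hγ : 0 < γ)
    {A : E m k → Matrix (Fin (m + k)) (Fin (m + k)) ℝ}
    (hA1 : C1coeff A) (hA2 : Symm A) {G : E m k → E m k} (hG : ContDiff ℝ 1 G)
    {u : E m k → ℝ} (hu : ContDiff ℝ (⊤ : ℕ∞) u) (hcs : HasCompactSupport u)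

include hu in
lemma f_C1 (i : Fin (m + k)) : ContDiff ℝ 1 (fun q => fderiv ℝ u q (bv i)) :=
  (hu.fderiv_right (m := 1) (by norm_cast)).clm_apply contDiff_const

include hcs in
lemma f_cs (i : Fin (m + k)) : HasCompactSupport (fun q => fderiv ℝ u q (bv i)) :=
  hcs.fderiv_apply ℝ _

include hu hG in
lemma g_C1 : ContDiff ℝ 1 (fun q => fderiv ℝ u q (G q)) :=
  (hu.fderiv_right (m := 1) (by norm_cast)).clm_apply hG

include hcs in
lemma g_cs : HasCompactSupport (fun q => fderiv ℝ u q (G q)) := by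
  refine (hcs.fderiv ℝ).mono ?_
  intro q hq h
  simp only [Function.mem_support] at hq
  exact hq (by rw [h]; rfl)

lemma Xu_eq (i : Fin (m + k)) :
    Xd γ i u = fun q => wt (gm m γ i) q * fderiv ℝ u q (bv i) := by
  funext q; exact Xd_eq γ i u q

include hu in
lemma Xu_diff (i : Fin (m + k)) {p : E m k} (hp : p.1 ≠ 0) : DifferentiableAt ℝ (Xd γ i u) p := by
  rw [Xu_eq]
  exact (hasFDerivAt_wt _ p hp).differentiableAt.fun_mul ((f_C1 hu i).differentiable one_ne_zero p)

include hu hγ in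
lemma Xu_cont (i : Fin (m + k)) : Continuous (Xd γ i u) := by
  rw [Xu_eq]
  exact (wt_continuous (gm_nonneg hγ i)).mul (f_C1 hu i).continuous

include hcs in
lemma Xu_cs (i : Fin (m + k)) : HasCompactSupport (Xd γ i u) := by
  rw [Xu_eq]
  exact (f_cs hcs i).mul_left

include hm hγ hA1 hG hu hcs in
lemma int1 : Integrable (fun p => fderiv ℝ u p (G p) * Lop γ A u p) := by
  have hgc := (g_C1 hG hu).continuous
  have key : Integrable (fun p => ∑ i, ∑ j,
      (fderiv ℝ u p (G p) * (wt (gm m γ i) p * (wt (gm m γ j) p *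
        fderiv ℝ (fun q => A q i j * fderiv ℝ u q (bv j)) p (bv i)))
      + dwt (gm m γ j) p ((fderiv ℝ u p (G p) * wt (gm m γ i) p *
          (A p i j * fderiv ℝ u p (bv j))) • bv i))) := by
    refine integrable_finsetSum _ fun i _ => integrable_finsetSum _ fun j _ => ?_
    have hw := wt_continuous (m := m) (k := k) (gm_nonneg hγ i)
    have hw' := wt_continuous (m := m) (k := k) (gm_nonneg hγ j)
    have haf : ContDiff ℝ 1 (fun q => A q i j * fderiv ℝ u q (bv j)) :=
      (hA1 i j).mul (f_C1 hu j)
    refine Integrable.add ?_ ?_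
    · refine Continuous.integrable_of_hasCompactSupport ?_ (g_cs hcs).mul_right
      exact hgc.mul (hw.mul (hw'.mul
        ((haf.continuous_fderiv one_ne_zero).clm_apply continuous_const)))
    · refine dwt_integrable hm (gm_nonneg hγ j) _ ?_ ?_
      · exact ((hgc.mul hw).mul haf.continuous).smul continuous_const
      · exact ((g_cs hcs).mul_right.mul_right).smul_right
  refine key.congr ?_
  filter_upwards [ae_ne hm] with p hp
  unfold Lop
  simp only [Finset.mul_sum]
  refine Finset.sum_congr rfl fun i _ => Finset.sum_congr rfl fun j _ => ?_
  have haf : ContDiff ℝ 1 (fun q => A q i j * fderiv ℝ u q (bv j)) :=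
    (hA1 i j).mul (f_C1 hu j)
  have e : (fun q => A q i j * Xd γ j u q) =
      fun q => wt (gm m γ j) q * (A q i j * fderiv ℝ u q (bv j)) := by
    funext q; rw [Xd_eq]; ring
  rw [Xd_eq, e, fderiv_wt_mul hp (haf.differentiable one_ne_zero p)]
  simp [dwt, inner_smul_right]; ring

include hγ hG hA1 hu hcs in
lemma int2 : Integrable (fun p => divV G p * quadA γ A u p) := by
  have h1 : Continuous (fun p => divV G p) := by
    simp only [divV_eq]
    refine continuous_finsetSum _ fun l _ => (cv l).continuous.comp ?_
    exact (hG.continuous_fderiv one_ne_zero).clm_apply continuous_const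
  simp only [quadA, Finset.mul_sum]
  refine integrable_finsetSum _ fun i _ => integrable_finsetSum _ fun j _ => ?_
  refine Continuous.integrable_of_hasCompactSupport ?_ (Xu_cs hcs j).mul_left.mul_left
  exact h1.mul (((hA1 i j).continuous.mul (Xu_cont hγ hu i)).mul (Xu_cont hγ hu j))

include hγ hG hA1 hu hcs in
lemma int3 : Integrable (fun p => ∑ i, ∑ j,
            fderiv ℝ (fun q => A q i j) p (G p) * Xd γ i u p * Xd γ j u p) := by
  refine integrable_finsetSum _ fun i _ => integrable_finsetSum _ fun j _ => ?_
  refine Continuous.integrable_of_hasCompactSupport ?_ (Xu_cs hcs j).mul_left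
  exact ((((hA1 i j).continuous_fderiv one_ne_zero).clm_apply hG.continuous).mul
    (Xu_cont hγ hu i)).mul (Xu_cont hγ hu j)

include hm hγ hA1 hG hu hcs in
lemma int4 : Integrable (fun p => ∑ i, ∑ j,
            A p i j * Xd γ i u p *
              (Xd γ j (fun q => fderiv ℝ u q (G q)) p
                - fderiv ℝ (Xd γ j u) p (G p))) := by
  refine integrable_finsetSum _ fun i _ => integrable_finsetSum _ fun j _ => ?_
  have hw := wt_continuous (m := m) (k := k) (gm_nonneg hγ j)
  have hx := Xu_cont hγ hu i
  have key : Integrable (fun p => (A p i j * Xd γ i u p) *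
      (wt (gm m γ j) p * fderiv ℝ (fun q => fderiv ℝ u q (G q)) p (bv j)
        - wt (gm m γ j) p * fderiv ℝ (fun q => fderiv ℝ u q (bv j)) p (G p))
      - dwt (gm m γ j) p ((A p i j * Xd γ i u p * fderiv ℝ u p (bv j)) • G p)) := by
    refine Integrable.sub ?_ ?_
    · refine Continuous.integrable_of_hasCompactSupport ?_ (Xu_cs hcs i).mul_left.mul_right
      refine ((hA1 i j).continuous.mul hx).mul ((hw.mul ?_).sub (hw.mul ?_))
      · exact ((g_C1 hG hu).continuous_fderiv one_ne_zero).clm_apply continuous_const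
      · exact ((f_C1 hu j).continuous_fderiv one_ne_zero).clm_apply hG.continuous
    · refine dwt_integrable hm (gm_nonneg hγ j) _ ?_ ?_
      · exact (((hA1 i j).continuous.mul hx).mul (f_C1 hu j).continuous).smul hG.continuous
      · exact ((f_cs hcs j).mul_left).smul_right
  refine key.congr ?_
  filter_upwards [ae_ne hm] with p hp
  rw [Xd_eq γ j, Xu_eq (u := u) j, fderiv_wt_mul hp ((f_C1 hu j).differentiable one_ne_zero p)]
  simp [dwt, inner_smul_right]; ring

include hm hγ hA1 hA2 hG hu hcs in
lemma global_identity :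
    2 * ∫ p, fderiv ℝ u p (G p) * Lop γ A u p
      = (∫ p, divV G p * quadA γ A u p)
        + (∫ p, ∑ i, ∑ j,
            fderiv ℝ (fun q => A q i j) p (G p) * Xd γ i u p * Xd γ j u p)
        - 2 * ∫ p, ∑ i, ∑ j,
            A p i j * Xd γ i u p *
              (Xd γ j (fun q => fderiv ℝ u q (G q)) p
                - fderiv ℝ (Xd γ j u) p (G p)) := by
  have i1 := int1 hm hγ hA1 hG hu hcs
  have i2 := int2 hγ hA1 hG hu hcs
  have i3 := int3 hγ hA1 hG hu hcs
  have i4 := int4 hm hγ hA1 hG hu hcs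
  let F : Fin (m + k) → Fin (m + k) → E m k → ℝ := fun i j q =>
    fderiv ℝ u q (G q) * (A q i j * fderiv ℝ u q (bv j))
  let H : Fin (m + k) → Fin (m + k) → Fin (m + k) → E m k → ℝ := fun i j l q =>
    A q i j * (fderiv ℝ u q (bv i) * fderiv ℝ u q (bv j)) * cv l (G q)
  have hF1 : ∀ i j, ContDiff ℝ 1 (F i j) := fun i j =>
    (g_C1 hG hu).mul ((hA1 i j).mul (f_C1 hu j))
  have hGl : ∀ l, ContDiff ℝ 1 (fun q => cv l (G q)) := fun l => (cv l).contDiff.comp hG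
  have hH1 : ∀ i j l, ContDiff ℝ 1 (H i j l) := fun i j l =>
    ((hA1 i j).mul ((f_C1 hu i).mul (f_C1 hu j))).mul (hGl l)
  have hFc : ∀ i j, HasCompactSupport (F i j) := fun i j => (g_cs hcs).mul_right
  have hHc : ∀ i j l, HasCompactSupport (H i j l) := fun i j l =>
    ((f_cs hcs j).mul_left.mul_left).mul_right
  have hα : ∀ i j : Fin (m + k), 0 ≤ gm m γ i + gm m γ j := fun i j =>
    add_nonneg (gm_nonneg hγ i) (gm_nonneg hγ j)
  have kF := fun i j => integral_wt hm (hα i j) (F i j) (hF1 i j) (hFc i j) (bv i)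
  have kH := fun i j l => integral_wt hm (hα i j) (H i j l) (hH1 i j l) (hHc i j l) (bv l)
  have z1 : ∫ p, (∑ i, ∑ j, 2 * (wt (gm m γ i + gm m γ j) p * fderiv ℝ (F i j) p (bv i)
        + dwt (gm m γ i + gm m γ j) p (bv i) * F i j p)) = 0 := by
    rw [integral_finsetSum _ fun i _ => integrable_finsetSum _ fun j _ => (kF i j).1.const_mul 2]
    refine Finset.sum_eq_zero fun i _ => ?_
    rw [integral_finsetSum _ fun j _ => (kF i j).1.const_mul 2]
    refine Finset.sum_eq_zero fun j _ => ?_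
    rw [integral_const_mul, (kF i j).2, mul_zero]
  have z2 : ∫ p, (∑ i, ∑ j, ∑ l, (wt (gm m γ i + gm m γ j) p * fderiv ℝ (H i j l) p (bv l)
        + dwt (gm m γ i + gm m γ j) p (bv l) * H i j l p)) = 0 := by
    rw [integral_finsetSum _ fun i _ => integrable_finsetSum _ fun j _ =>
      integrable_finsetSum _ fun l _ => (kH i j l).1]
    refine Finset.sum_eq_zero fun i _ => ?_
    rw [integral_finsetSum _ fun j _ => integrable_finsetSum _ fun l _ => (kH i j l).1]
    refine Finset.sum_eq_zero fun j _ => ?_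
    rw [integral_finsetSum _ fun l _ => (kH i j l).1]
    exact Finset.sum_eq_zero fun l _ => (kH i j l).2
  have n1 : Integrable (fun p => ∑ i, ∑ j, 2 * (wt (gm m γ i + gm m γ j) p *
      fderiv ℝ (F i j) p (bv i) + dwt (gm m γ i + gm m γ j) p (bv i) * F i j p)) :=
    integrable_finsetSum _ fun i _ => integrable_finsetSum _ fun j _ => (kF i j).1.const_mul 2
  have n2 : Integrable (fun p => ∑ i, ∑ j, ∑ l, (wt (gm m γ i + gm m γ j) p *
      fderiv ℝ (H i j l) p (bv l) + dwt (gm m γ i + gm m γ j) p (bv l) * H i j l p)) :=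
    integrable_finsetSum _ fun i _ => integrable_finsetSum _ fun j _ =>
      integrable_finsetSum _ fun l _ => (kH i j l).1
  have z := integral_sub n1 n2
  rw [z1, z2, sub_zero] at z
  have lhs := integral_add (((i1.const_mul 2).sub i2).sub i3) (i4.const_mul 2)
  have l2 := integral_sub ((i1.const_mul 2).sub i2) i3
  have l3 := integral_sub (i1.const_mul 2) i2
  simp only [Pi.sub_apply] at lhs l2 l3
  rw [l2, l3, integral_const_mul, integral_const_mul] at lhs
  rw [← sub_eq_zero]
  refine Eq.trans ?_ z
  trans
  swap
  · refine Eq.trans lhs.symm ?_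
    refine integral_congr_ae ?_
    filter_upwards [ae_ne hm] with p hp
    have dg : DifferentiableAt ℝ (fun q => fderiv ℝ u q (G q)) p :=
      (g_C1 hG hu).differentiable one_ne_zero p
    have da : ∀ i j, DifferentiableAt ℝ (fun q => A q i j) p := fun i j =>
      (hA1 i j).differentiable one_ne_zero p
    have dx : ∀ i, DifferentiableAt ℝ (Xd γ i u) p := fun i => Xu_diff hu i hp
    have r1 : ∀ i j, wt (gm m γ i + gm m γ j) p * fderiv ℝ (F i j) p (bv i)
        + dwt (gm m γ i + gm m γ j) p (bv i) * F i j p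
        = fderiv ℝ u p (G p) * Xd γ i (fun q => A q i j * Xd γ j u q) p
          + Xd γ i (fun q => fderiv ℝ u q (G q)) p * (A p i j * Xd γ j u p) := by
      intro i j
      rw [← fderiv_wt_mul hp ((hF1 i j).differentiable one_ne_zero p)]
      have e : (fun q => wt (gm m γ i + gm m γ j) q * F i j q) =
          fun q => wt (gm m γ i) q * (fderiv ℝ u q (G q) * (A q i j * Xd γ j u q)) := by
        funext q
        rw [wt_add (gm_nonneg hγ i) (gm_nonneg hγ j), Xd_eq]; simp only [F]; ring
      rw [e, fderiv_wt_mul hp (dg.fun_mul ((da i j).fun_mul (dx j))), dwt_bv,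
        fderiv_mul_app dg ((da i j).fun_mul (dx j)), Xd_eq γ i, Xd_eq γ i]
      ring
    have r2 : ∀ i j, ∑ l, (wt (gm m γ i + gm m γ j) p * fderiv ℝ (H i j l) p (bv l)
        + dwt (gm m γ i + gm m γ j) p (bv l) * H i j l p)
        = A p i j * (Xd γ i u p * Xd γ j u p) * divV G p
          + (A p i j * (Xd γ i u p * fderiv ℝ (Xd γ j u) p (G p)
              + fderiv ℝ (Xd γ i u) p (G p) * Xd γ j u p)
            + fderiv ℝ (fun q => A q i j) p (G p) * (Xd γ i u p * Xd γ j u p)) := by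
      intro i j
      have dQ := (da i j).fun_mul ((dx i).fun_mul (dx j))
      have e : ∀ l, (fun q => wt (gm m γ i + gm m γ j) q * H i j l q) =
          fun q => A q i j * (Xd γ i u q * Xd γ j u q) * cv l (G q) := by
        intro l; funext q
        rw [wt_add (gm_nonneg hγ i) (gm_nonneg hγ j), Xd_eq, Xd_eq]; simp only [H]; ring
      have cG : ∀ l, fderiv ℝ (fun q => cv l (G q)) p (bv l) = cv l (fderiv ℝ G p (bv l)) := by
        intro l
        have := ((cv l).hasFDerivAt.comp p (hG.differentiable one_ne_zero p).hasFDerivAt).fderiv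
        have e2 : (fun q => cv l (G q)) = (cv l) ∘ G := rfl
        rw [e2, this]; rfl
      have t : ∀ l, (wt (gm m γ i + gm m γ j) p * fderiv ℝ (H i j l) p (bv l)
          + dwt (gm m γ i + gm m γ j) p (bv l) * H i j l p)
          = A p i j * (Xd γ i u p * Xd γ j u p) * cv l (fderiv ℝ G p (bv l))
            + fderiv ℝ (fun q => A q i j * (Xd γ i u q * Xd γ j u q)) p (cv l (G p) • bv l) := by
        intro l
        rw [← fderiv_wt_mul hp ((hH1 i j l).differentiable one_ne_zero p), e l,
          fderiv_mul_app dQ ((hGl l).differentiable one_ne_zero p), cG, map_smul, smul_eq_mul]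
        ring
      rw [Finset.sum_congr rfl fun l _ => t l, Finset.sum_add_distrib, ← Finset.mul_sum,
        ← divV_eq, ← map_sum, sum_cv, fderiv_mul_app (da i j) ((dx i).fun_mul (dx j)),
        fderiv_mul_app (dx i) (dx j)]
    simp only [r1, r2, Lop, quadA]
    exact alg (A p) (fun i j => Xd γ i (fun q => A q i j * Xd γ j u q) p)
      (fun i j => fderiv ℝ (fun q => A q i j) p (G p)) (fun i => Xd γ i u p)
      (fun i => fderiv ℝ (Xd γ i u) p (G p)) (fun i => Xd γ i (fun q => fderiv ℝ u q (G q)) p)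
      (fderiv ℝ u p (G p)) (divV G p) (hA2 p)
  · ring

end main

lemma exists_global (G : E m k → E m k) (U K : Set (E m k)) (hU : IsOpen U) (hK : IsClosed K)
    (hKU : K ⊆ U) (hG : ContDiffOn ℝ 1 G U) :
    ∃ G' : E m k → E m k, ContDiff ℝ 1 G' ∧ ∀ p ∈ K, G' =ᶠ[𝓝 p] G := by
  obtain ⟨f, h0, h1, -⟩ := exists_contMDiffMap_zero_one_nhds_of_isClosed (n := 1)
    (modelWithCornersSelf ℝ (E m k)) hU.isClosed_compl hK
    (disjoint_compl_left_iff_subset.mpr hKU)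
  have hf : ContDiff ℝ 1 f := f.contMDiff.contDiff
  refine ⟨fun p => f p • G p, ?_, ?_⟩
  · rw [contDiff_iff_contDiffAt]
    intro p
    by_cases hp : p ∈ U
    · exact hf.contDiffAt.smul (hG.contDiffAt (hU.mem_nhds hp))
    · have : ∀ᶠ q in 𝓝 p, f q = 0 := h0.filter_mono (nhds_le_nhdsSet hp)
      refine (contDiffAt_const (c := (0 : E m k))).congr_of_eventuallyEq ?_
      filter_upwards [this] with q hq
      simp [hq]
  · intro p hp
    have : ∀ᶠ q in 𝓝 p, f q = 1 := h1.filter_mono (nhds_le_nhdsSet hp)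
    filter_upwards [this] with q hq
    simp [hq]

end BGaux

open BG in
/-- the Rellich-type identity (Lemma 2.11 of Garofalo–Vassilev),
for compactly supported u (so that all boundary terms vanish, div X_i = 0). -/
theorem rellich_identity
    (m k : ℕ) (hm : 1 ≤ m) (hk : 1 ≤ k) (γ : ℝ) (hγ : 0 < γ)
    (R : ℝ) (hR : 0 < R)
    (A : E m k → Matrix (Fin (m + k)) (Fin (m + k)) ℝ)
    (hA1 : C1coeff A) (hA2 : Symm A)
    (G : E m k → E m k) (U : Set (E m k)) (hU : IsOpen U)
    (hUB : closure (ball γ R) ⊆ U) (hG : ContDiffOn ℝ 1 G U)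
    (u : E m k → ℝ) (hu : ContDiff ℝ (⊤ : ℕ∞) u) (hcs : HasCompactSupport u)
    (hsupp : tsupport u ⊆ ball γ R) :
    2 * ∫ p in ball γ R, fderiv ℝ u p (G p) * Lop γ A u p
      = (∫ p in ball γ R, divV G p * quadA γ A u p)
        + (∫ p in ball γ R, ∑ i, ∑ j,
            fderiv ℝ (fun q => A q i j) p (G p) * Xd γ i u p * Xd γ j u p)
        - 2 * ∫ p in ball γ R, ∑ i, ∑ j,
            A p i j * Xd γ i u p *
              (Xd γ j (fun q => fderiv ℝ u q (G q)) p
                - fderiv ℝ (Xd γ j u) p (G p)) := by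
  obtain ⟨G', hG', hGG⟩ := BGaux.exists_global G U (tsupport u) hU (isClosed_tsupport u)
    (hsupp.trans (subset_closure.trans hUB)) hG
  have hz : ∀ p, p ∉ tsupport u → fderiv ℝ u p = 0 := fun p hp => by
    by_contra h
    exact hp (support_fderiv_subset ℝ h)
  have hz' : ∀ p ∉ ball γ R, fderiv ℝ u p = 0 := fun p hp => hz p fun h => hp (hsupp h)
  have hX : ∀ p, fderiv ℝ u p = 0 → ∀ i, Xd γ i u p = 0 := fun p hp i => by
    simp [Xd, hp]
  rw [setIntegral_eq_integral_of_forall_compl_eq_zero (fun p hp => by simp [hz' p hp]),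
    setIntegral_eq_integral_of_forall_compl_eq_zero
      (fun p hp => by simp [quadA, hX p (hz' p hp)]),
    setIntegral_eq_integral_of_forall_compl_eq_zero
      (fun p hp => by simp [hX p (hz' p hp)]),
    setIntegral_eq_integral_of_forall_compl_eq_zero
      (fun p hp => by simp [hX p (hz' p hp)])]
  have main := BGaux.global_identity hm hγ hA1 hA2 hG' hu hcs
  convert main using 2
  · congr 1
    funext p
    by_cases hp : p ∈ tsupport u
    · rw [(hGG p hp).self_of_nhds]
    · simp [hz p hp]
  · congr 1
    · congr 1
      funext p
      by_cases hp : p ∈ tsupport u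
      · simp only [divV, (hGG p hp).fderiv_eq]
      · simp [quadA, hX p (hz p hp)]
    · congr 1
      funext p
      by_cases hp : p ∈ tsupport u
      · rw [(hGG p hp).self_of_nhds]
      · simp [hX p (hz p hp)]
  · congr 2
    funext p
    by_cases hp : p ∈ tsupport u
    · have e : (fun q => fderiv ℝ u q (G' q)) =ᶠ[nhds p] fun q => fderiv ℝ u q (G q) := by
        filter_upwards [hGG p hp] with q hq
        rw [hq]
      simp only [Xd, e.fderiv_eq, (hGG p hp).self_of_nhds]
    · simp [hX p (hz p hp)]
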